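/- (Product Formula) For every plane rooted tree T, Q(T) = Π_{v ∈ V(T)} W(v), where W(v) is the q-multinomial weight of the vertex v determined by the edge counts of the branches of T at v. -/

import Mathlib

/-- A plane rooted tree: a root with an ordered list of plane rooted subtrees. -/
inductive PTree : Type where
  | node : List PTree → PTree

namespace PTree

mutual
/-- Number of edges of a plane rooted tree. -/
def edges : PTree → ℕ
  | .node l => edgesL l
def edgesL : List PTree → ℕ
  | [] => 0
  | t :: ts => (edges t + 1) + edgesL ts
end

mutual
/-- Number of vertices of a plane rooted tree. -/
def vertices : PTree → ℕ
  | .node l => 1 + verticesL l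
def verticesL : List PTree → ℕ
  | [] => 0
  | t :: ts => vertices t + verticesL ts
end

mutual
/-- `plucks T` is the list, indexed by the leaves `v` of `T`, of the pairs
`(r(T,v), T - v)`, where `r(T,v)` is the number of vertices strictly to the
right of the path from `v` to the root, and `T - v` is `T` with the leaf `v`
(and its edge) deleted. -/
def plucks : PTree → List (ℕ × PTree)
  | .node l => (plucksL l).map (fun p => (p.1, PTree.node p.2))
def plucksL : List PTree → List (ℕ × List PTree)
  | [] => []
  | t :: ts =>
      (match t with
       | .node [] => [(verticesL ts, ts)]
       | .node (s :: ss) =>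
          (plucks (.node (s :: ss))).map (fun p => (p.1 + verticesL ts, p.2 :: ts)))
      ++ (plucksL ts).map (fun p => (p.1, t :: p.2))
end

/-- The plucking polynomial, computed with a fuel parameter (the fuel is the
number of edges; each plucking removes exactly one edge). -/
noncomputable def Qfuel : ℕ → PTree → Polynomial ℤ
  | 0, _ => 1
  | (k+1), t =>
      if edges t = 0 then 1
      else ((plucks t).map (fun p => Polynomial.X ^ p.1 * Qfuel k p.2)).sum

/-- The plucking polynomial `Q(T)` of a plane rooted tree: `Q(T) = 1` if `T` has
no edges, and otherwise `Q(T) = Σ_v q^{r(T,v)} Q(T - v)`, summed over the leaves of `T`. -/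
noncomputable def Q (t : PTree) : Polynomial ℤ := Qfuel (edges t) t

end PTree

/-- The `q`-analogue `[a]_q = 1 + q + ⋯ + q^{a-1}`. -/
noncomputable def qInt (a : ℕ) : Polynomial ℤ := (Finset.range a).sum (fun i => Polynomial.X ^ i)

/-- The `q`-factorial `[a]_q! = [1]_q [2]_q ⋯ [a]_q`. -/
noncomputable def qFact : ℕ → Polynomial ℤ
  | 0 => 1
  | (a+1) => qFact a * qInt (a+1)

/-- The `q`-multinomial coefficient
`(a₁+⋯+a_k choose a₁,…,a_k)_q = [a₁+⋯+a_k]_q! / ([a₁]_q! ⋯ [a_k]_q!)`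
(the division, by a monic polynomial, is exact). -/
noncomputable def qMultinomial (l : List ℕ) : Polynomial ℤ :=
  qFact l.sum /ₘ (l.map qFact).prod

/-- The Gaussian binomial coefficient `(a+c choose a)_q`. -/
noncomputable def qBinom (a c : ℕ) : Polynomial ℤ := qMultinomial [a, c]


namespace PTree

mutual
/-- `Wprod T = Π_{v ∈ V(T)} W(v)`, where for a vertex `v` with branches
`T₁^v, …, T_{k(v)}^v` the weight `W(v)` is the `q`-multinomial coefficient
`(|E(T^v)| choose |E(T₁^v)|, …, |E(T_{k(v)}^v)|)_q`; the branch `Tᵢ^v` consists of `v`,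
the edge from `v` to its `i`-th child `cᵢ`, and the subtree rooted at `cᵢ`, so
`|E(Tᵢ^v)| = edges cᵢ + 1`. -/
noncomputable def Wprod : PTree → Polynomial ℤ
  | .node l => qMultinomial (l.map (fun c => edges c + 1)) * WprodL l
noncomputable def WprodL : List PTree → Polynomial ℤ
  | [] => 1
  | t :: ts => Wprod t * WprodL ts
end

end PTree

/-- The Gaussian binomial coefficient `(a+c choose a)_q`, defined by the `q`-Pascal rule. -/
noncomputable def qPascal : ℕ → ℕ → Polynomial ℤ
  | 0, _ => 1
  | _ + 1, 0 => 1
  | a + 1, c + 1 => Polynomial.X ^ (c + 1) * qPascal a (c + 1) + qPascal (a + 1) c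

theorem qPascal_zero_right (a : ℕ) : qPascal a 0 = 1 := by
  cases a <;> simp [qPascal]

theorem qInt_add (a c : ℕ) : qInt (a + c) = qInt a + Polynomial.X ^ a * qInt c := by
  simp [qInt, Finset.sum_range_add, Finset.mul_sum, pow_add]

theorem qPascal_mul_qFact_mul_qFact (a c : ℕ) :
    qPascal a c * (qFact a * qFact c) = qFact (a + c) := by
  induction a generalizing c with
  | zero => simp [qPascal, qFact]
  | succ a iha =>
    induction c with
    | zero => simp [qPascal, qFact]
    | succ c ihc =>
      have h₁ := iha (c + 1)
      have h₂ : qFact (a + 1 + (c + 1)) = qFact (a + c + 1) * qInt (c + 1 + (a + 1)) := by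
        rw [show a + 1 + (c + 1) = a + c + 1 + 1 by ring, qFact,
          show a + c + 1 + 1 = c + 1 + (a + 1) by ring]
      rw [h₂, qInt_add, qPascal]
      rw [show a + (c + 1) = a + c + 1 by ring] at h₁
      rw [show a + 1 + c = a + c + 1 by ring] at ihc
      have ha : qFact (a + 1) = qFact a * qInt (a + 1) := rfl
      have hc : qFact (c + 1) = qFact c * qInt (c + 1) := rfl
      linear_combination
        Polynomial.X ^ (c + 1) * qInt (a + 1) * h₁ + qInt (c + 1) * ihc
          + Polynomial.X ^ (c + 1) * qPascal a (c + 1) * qFact (c + 1) * ha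
          + qPascal (a + 1) c * qFact (a + 1) * hc

theorem monic_qFact (a : ℕ) : (qFact a).Monic := by
  induction a with
  | zero => exact Polynomial.monic_one
  | succ a ih => exact ih.mul (Polynomial.monic_geom_sum_X a.succ_ne_zero)

theorem monic_prod_map_qFact (l : List ℕ) : (l.map qFact).prod.Monic := by
  induction l with
  | nil => simp
  | cons a l ih => simpa using (monic_qFact a).mul ih

theorem qMultinomial_eq_of_mul_prod_eq {l : List ℕ} {p : Polynomial ℤ}
    (h : p * (l.map qFact).prod = qFact l.sum) : qMultinomial l = p := by
  rw [qMultinomial, ← h, mul_comm, Polynomial.mul_divByMonic_cancel_left _ (monic_prod_map_qFact l)]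

theorem qMultinomial_mul_prod (l : List ℕ) :
    qMultinomial l * (l.map qFact).prod = qFact l.sum := by
  induction l with
  | nil => simp [qMultinomial_eq_of_mul_prod_eq (l := []) (p := 1) (by simp [qFact]), qFact]
  | cons a l ih =>
    have h : qPascal a l.sum * qMultinomial l * ((a :: l).map qFact).prod
        = qFact (a :: l).sum := by
      rw [List.map_cons, List.prod_cons, List.sum_cons]
      linear_combination
        qPascal a l.sum * qFact a * ih + qPascal_mul_qFact_mul_qFact a l.sum
    rw [qMultinomial_eq_of_mul_prod_eq h, h]

theorem qMultinomial_cons (a : ℕ) (l : List ℕ) :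
    qMultinomial (a :: l) = qPascal a l.sum * qMultinomial l := by
  apply qMultinomial_eq_of_mul_prod_eq
  rw [List.map_cons, List.prod_cons, List.sum_cons]
  linear_combination
    qPascal a l.sum * qFact a * qMultinomial_mul_prod l + qPascal_mul_qFact_mul_qFact a l.sum

namespace PTree

theorem sum_map_edges_add_one (l : List PTree) :
    (l.map (fun c => edges c + 1)).sum = edgesL l := by
  induction l with
  | nil => simp [edgesL]
  | cons t ts ih => simp [edgesL, ih]

mutual
theorem vertices_eq : ∀ t : PTree, vertices t = edges t + 1
  | .node l => by rw [vertices, edges, verticesL_eq l, add_comm]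
theorem verticesL_eq : ∀ l : List PTree, verticesL l = edgesL l
  | [] => by rw [verticesL, edgesL]
  | t :: ts => by rw [verticesL, edgesL, vertices_eq t, verticesL_eq ts]
end

theorem Wprod_node_nil : Wprod (.node []) = 1 := by
  rw [Wprod, WprodL, List.map_nil,
    qMultinomial_eq_of_mul_prod_eq (l := []) (p := 1) (by simp [qFact]), one_mul]

theorem Wprod_node_cons (t : PTree) (ts : List PTree) :
    Wprod (.node (t :: ts)) =
      qPascal (edges t + 1) (edgesL ts) * Wprod t * Wprod (.node ts) := by
  rw [Wprod, Wprod, WprodL, List.map_cons, qMultinomial_cons, sum_map_edges_add_one]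
  ring

theorem plucksL_leaf_cons (ts : List PTree) :
    plucksL (.node [] :: ts) =
      (verticesL ts, ts) :: (plucksL ts).map (fun p => (p.1, .node [] :: p.2)) := by
  rw [plucksL]; rfl

theorem plucksL_node_cons_cons (s : PTree) (ss ts : List PTree) :
    plucksL (.node (s :: ss) :: ts) =
      (plucks (.node (s :: ss))).map (fun p => (p.1 + verticesL ts, p.2 :: ts))
        ++ (plucksL ts).map (fun p => (p.1, .node (s :: ss) :: p.2)) := by
  rw [plucksL]

mutual
theorem edges_of_mem_plucks : ∀ t : PTree, ∀ p ∈ plucks t, edges p.2 + 1 = edges t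
  | .node l, p, hp => by
    rw [plucks, List.mem_map] at hp
    obtain ⟨p', hp', rfl⟩ := hp
    simpa [edges] using edgesL_of_mem_plucksL l p' hp'
theorem edgesL_of_mem_plucksL : ∀ l : List PTree, ∀ p ∈ plucksL l, edgesL p.2 + 1 = edgesL l
  | [], p, hp => by simp [plucksL] at hp
  | .node [] :: ts, p, hp => by
    rw [plucksL_leaf_cons, List.mem_cons, List.mem_map] at hp
    obtain rfl | ⟨p', hp', rfl⟩ := hp
    · simp [edgesL, edges, add_comm]
    · have := edgesL_of_mem_plucksL ts p' hp'
      simp only [edgesL]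
      lia
  | .node (s :: ss) :: ts, p, hp => by
    rw [plucksL_node_cons_cons, List.mem_append, List.mem_map, List.mem_map] at hp
    obtain ⟨p', hp', rfl⟩ | ⟨p', hp', rfl⟩ := hp
    · have := edges_of_mem_plucks (.node (s :: ss)) p' hp'
      simp only [edgesL]
      lia
    · have := edgesL_of_mem_plucksL ts p' hp'
      simp only [edgesL]
      lia
end

/-- The weighted sum of `Wprod` over the trees obtained by plucking a leaf of a forest `l`
hanging from a common root. -/
noncomputable def pluckSum (l : List PTree) : Polynomial ℤ :=
  ((plucksL l).map (fun p => Polynomial.X ^ p.1 * Wprod (.node p.2))).sum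

theorem sum_map_plucks (l : List PTree) :
    ((plucks (.node l)).map (fun p => Polynomial.X ^ p.1 * Wprod p.2)).sum = pluckSum l := by
  rw [plucks, List.map_map]; rfl

/-- The contribution to `pluckSum (t :: ts)` of the leaves lying in `ts`. -/
theorem sum_map_plucksL_tail (t : PTree) (ts : List PTree)
    (h : ts ≠ [] → pluckSum ts = Wprod (.node ts)) :
    ((plucksL ts).map (fun p => Polynomial.X ^ p.1 * Wprod (.node (t :: p.2)))).sum =
      (qPascal (edges t + 1) (edgesL ts) - Polynomial.X ^ edgesL ts * qPascal (edges t) (edgesL ts))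
        * Wprod t * Wprod (.node ts) := by
  rcases ts with _ | ⟨s, ss⟩
  · simp [plucksL, edgesL, qPascal_zero_right]
  · obtain ⟨n, hn⟩ : ∃ n, edgesL (s :: ss) = n + 1 := ⟨edges s + edgesL ss, by rw [edgesL]; ring⟩
    have hsum : (plucksL (s :: ss)).map
          (fun p => Polynomial.X ^ p.1 * Wprod (.node (t :: p.2))) =
        (plucksL (s :: ss)).map (fun p => qPascal (edges t + 1) n * Wprod t *
          (Polynomial.X ^ p.1 * Wprod (.node p.2))) := by
      refine List.map_congr_left fun p hp => ?_
      have hp' : edgesL p.2 = n := by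
        have := edgesL_of_mem_plucksL _ p hp
        lia
      rw [Wprod_node_cons, hp']
      ring
    have hs : pluckSum (s :: ss) = Wprod (.node (s :: ss)) := h (by simp)
    rw [hsum, List.sum_map_mul_left, ← pluckSum, hs, hn, qPascal]
    ring

/-- The contribution to `pluckSum (t :: ts)` of the leaves lying in `t`, when `t` is not a
single vertex. -/
theorem sum_map_plucks_head (t : PTree) (ts : List PTree)
    (h : ((plucks t).map (fun p => Polynomial.X ^ p.1 * Wprod p.2)).sum = Wprod t) :
    ((plucks t).map
        (fun p => Polynomial.X ^ (p.1 + edgesL ts) * Wprod (.node (p.2 :: ts)))).sum =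
      Polynomial.X ^ edgesL ts * qPascal (edges t) (edgesL ts) * Wprod t * Wprod (.node ts) := by
  have hsum : (plucks t).map
        (fun p => Polynomial.X ^ (p.1 + edgesL ts) * Wprod (.node (p.2 :: ts))) =
      (plucks t).map (fun p => Polynomial.X ^ edgesL ts * qPascal (edges t) (edgesL ts) *
        Wprod (.node ts) * (Polynomial.X ^ p.1 * Wprod p.2)) := by
    refine List.map_congr_left fun p hp => ?_
    rw [Wprod_node_cons, edges_of_mem_plucks t p hp]
    ring
  rw [hsum, List.sum_map_mul_left, h]
  ring

theorem pluckSum_eq_Wprod : ∀ l : List PTree, l ≠ [] → pluckSum l = Wprod (.node l)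
  | [], h => absurd rfl h
  | .node [] :: ts, _ => by
    have ht := sum_map_plucksL_tail (.node []) ts (pluckSum_eq_Wprod ts)
    rw [pluckSum, plucksL_leaf_cons, List.map_cons, List.map_map, List.sum_cons, verticesL_eq]
    simp only [Function.comp_def]
    rw [ht, Wprod_node_cons, Wprod_node_nil, edges, edgesL, qPascal]
    ring
  | .node (s :: ss) :: ts, _ => by
    have ht := sum_map_plucksL_tail (.node (s :: ss)) ts (pluckSum_eq_Wprod ts)
    have hh := sum_map_plucks_head (.node (s :: ss)) ts
      ((sum_map_plucks _).trans (pluckSum_eq_Wprod (s :: ss) (by simp)))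
    rw [pluckSum, plucksL_node_cons_cons, List.map_append, List.map_map, List.map_map,
      List.sum_append, verticesL_eq]
    simp only [Function.comp_def]
    rw [ht, hh, Wprod_node_cons _ ts]
    ring

theorem Qfuel_eq_Wprod (k : ℕ) (t : PTree) (h : edges t = k) : Qfuel k t = Wprod t := by
  induction k generalizing t with
  | zero =>
    rcases t with ⟨_ | ⟨s, ss⟩⟩
    · rw [Qfuel, Wprod_node_nil]
    · simp [edges, edgesL] at h
  | succ k ih =>
    rcases t with ⟨l⟩
    have hl : l ≠ [] := by
      rintro rfl
      simp [edges, edgesL] at h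
    rw [Qfuel, if_neg (by lia), ← pluckSum_eq_Wprod l hl, ← sum_map_plucks]
    refine congrArg List.sum (List.map_congr_left fun p hp => ?_)
    have hp' := edges_of_mem_plucks _ p hp
    rw [ih p.2 (by lia)]

end PTree

/-- **Product formula.** For every plane rooted tree `T`,
`Q(T) = Π_{v ∈ V(T)} W(v)`, where `W(v)` is the `q`-multinomial weight of the vertex `v`
determined by the edge counts of the branches of `T` at `v`. -/
theorem plucking_product_formula (t : PTree) : PTree.Q t = PTree.Wprod t :=
  PTree.Qfuel_eq_Wprod _ t rfl
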